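/- (Minimum principle on an unbounded domain) Let Ω = ℝᵈ × [0,T]. Suppose a : Ω → ℝ satisfies a_0 ≤ a(x,t) ≤ ε(r) r² + C with r = |x| and ε(r) → 0 as r → ∞, where a_0 > 0. Suppose v ∈ C^{2,1}(Ω) satisfies v(x,t) > −m for some m > 0, ∂v/∂t − a Δv ≥ 0 in Ω, and v(x, 0) ≥ 0 for all x. Then v(x,t) ≥ 0 for all (x,t) ∈ Ω. -/

import Mathlib

noncomputable def pd {d : ℕ} (f : EuclideanSpace ℝ (Fin d) → ℝ) (i : Fin d)
    (x : EuclideanSpace ℝ (Fin d)) : ℝ :=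
  fderiv ℝ f x (EuclideanSpace.single i 1)

noncomputable def lap {d : ℕ} (f : EuclideanSpace ℝ (Fin d) → ℝ)
    (x : EuclideanSpace ℝ (Fin d)) : ℝ :=
  ∑ i : Fin d, pd (fun y => pd f i y) i x

noncomputable def gradSq {d : ℕ} (f : EuclideanSpace ℝ (Fin d) → ℝ)
    (x : EuclideanSpace ℝ (Fin d)) : ℝ :=
  ∑ i : Fin d, (pd f i x) ^ 2

noncomputable def dt {d : ℕ} (f : EuclideanSpace ℝ (Fin d) → ℝ → ℝ)
    (x : EuclideanSpace ℝ (Fin d)) (t : ℝ) : ℝ :=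
  deriv (fun s => f x s) t


open Filter Topology

lemma aux_second {f f' : ℝ → ℝ} {c : ℝ} (hf : ∀ s, HasDerivAt f (f' s) s)
    (hf' : HasDerivAt f' c 0) (hmin : ∀ s, f 0 ≤ f s) : 0 ≤ c := by
  by_contra hc
  push Not at hc
  have hd : deriv f = f' := funext fun s => (hf s).deriv
  have hloc : IsLocalMin f 0 := Eventually.of_forall hmin
  have h0 : deriv f 0 = 0 := hloc.deriv_eq_zero
  have hmax : IsLocalMax f 0 := by
    apply isLocalMax_of_deriv_deriv_neg _ h0 (hf 0).continuousAt
    rw [hd, hf'.deriv]; exact hc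
  have heq : f =ᶠ[𝓝 0] fun _ => f 0 := by
    filter_upwards [hmax] with s hs
    exact le_antisymm hs (hmin s)
  have h2 : deriv f =ᶠ[𝓝 0] deriv (fun _ : ℝ => f 0) := heq.deriv
  have h3 := h2.deriv_eq
  rw [hd, hf'.deriv] at h3
  simp at h3
  linarith

lemma aux_left {f : ℝ → ℝ} {c t : ℝ} (ht : 0 < t) (hf : HasDerivAt f c t)
    (hmin : ∀ s, 0 ≤ s → s ≤ t → f t ≤ f s) : c ≤ 0 := by
  have h1 : Tendsto (slope f t) (𝓝[<] t) (𝓝 c) := by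
    have := (hf.hasDerivWithinAt (s := Set.Iio t))
    rwa [hasDerivWithinAt_iff_tendsto_slope' (by simp)] at this
  refine le_of_tendsto h1 ?_
  have : Set.Ioo 0 t ∈ 𝓝[<] t := Ioo_mem_nhdsLT ht
  filter_upwards [this] with s hs
  rw [slope_def_field]
  apply div_nonpos_of_nonneg_of_nonpos
  · linarith [hmin s hs.1.le hs.2.le]
  · linarith [hs.2]

lemma aux_max (n : ℕ) (u : ℝ) :
    HasDerivAt (fun u : ℝ => (max 0 u) ^ (n + 2)) ((n + 2 : ℕ) * (max 0 u) ^ (n + 1)) u := by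
  have hpow : HasDerivAt (fun u : ℝ => u ^ (n + 2)) ((n + 2 : ℕ) * u ^ (n + 1)) u := by
    simpa using hasDerivAt_pow (n + 2) u
  rcases lt_trichotomy u 0 with h | h | h
  · have he : (fun u : ℝ => (max 0 u) ^ (n + 2)) =ᶠ[𝓝 u] fun _ => 0 := by
      filter_upwards [Iio_mem_nhds h] with s hs
      rw [max_eq_left (le_of_lt hs)]; simp
    rw [max_eq_left h.le]
    simpa using (hasDerivAt_const u (0:ℝ)).congr_of_eventuallyEq he
  · subst h
    have h1 : HasDerivWithinAt (fun u : ℝ => (max 0 u) ^ (n + 2)) 0 (Set.Iic 0) 0 := by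
      refine (hasDerivWithinAt_const (0:ℝ) (Set.Iic 0) (0:ℝ)).congr ?_ (by simp)
      intro s hs
      simp only [max_eq_left (show s ≤ 0 from hs)]; simp
    have h2 : HasDerivWithinAt (fun u : ℝ => (max 0 u) ^ (n + 2)) 0 (Set.Ici 0) 0 := by
      have := hpow.hasDerivWithinAt (s := Set.Ici 0)
      simp only [ne_eq, Nat.add_eq_zero_iff, one_ne_zero, and_false, not_false_eq_true, zero_pow,
        mul_zero] at this
      refine this.congr ?_ (by simp)
      intro s hs
      simp only [max_eq_right (show 0 ≤ s from hs)]
    have h3 := h1.union h2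
    rw [Set.Iic_union_Ici, hasDerivWithinAt_univ] at h3
    simpa using h3
  · have he : (fun u : ℝ => (max 0 u) ^ (n + 2)) =ᶠ[𝓝 u] fun u => u ^ (n + 2) := by
      filter_upwards [Ioi_mem_nhds h] with s hs
      rw [max_eq_right (le_of_lt hs)]
    rw [max_eq_right h.le]
    exact hpow.congr_of_eventuallyEq he

lemma aux_norm {d : ℕ} (x : EuclideanSpace ℝ (Fin d)) (i : Fin d) (s : ℝ) :
    ‖x + s • EuclideanSpace.single i (1:ℝ)‖ ^ 2 = ‖x‖ ^ 2 + 2 * s * x i + s ^ 2 := by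
  rw [norm_add_sq_real, inner_smul_right, norm_smul, EuclideanSpace.inner_single_right]
  simp
  ring

lemma aux_poly (D S B u : ℝ) (hD : 0 ≤ D) (hS : 0 ≤ S) (hB : 0 ≤ B) (hu : 0 ≤ u) :
    (u + B) * (6 * D * u ^ 2 + 24 * u * (u + S)) ≤
      (6 * D + 24 + 24 * S + 6 * D * B + 24 * B + 24 * B * S) * (u ^ 3 + 1) := by
  have h3 : 0 ≤ u ^ 3 := by positivity
  have h1 : u ≤ u ^ 3 + 1 := by nlinarith [mul_nonneg hu (sq_nonneg (u - 1)), sq_nonneg (u-1)]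
  have h2 : u ^ 2 ≤ u ^ 3 + 1 := by
    nlinarith [mul_nonneg hu (sq_nonneg (u - 1)), sq_nonneg (u-1)]
  have k1 := mul_le_mul_of_nonneg_left h1 (show 0 ≤ 24 * B * S by positivity)
  have k2 := mul_le_mul_of_nonneg_left h2 (show 0 ≤ 24 * S + 6 * D * B + 24 * B by positivity)
  have k3 := mul_le_mul_of_nonneg_left (show u ^ 3 ≤ u ^ 3 + 1 by linarith)
    (show 0 ≤ 6 * D + 24 by positivity)
  linarith

/-- Laplacian inequality at a spatial minimum of `f + k * max 0 (r² - S)^3`. -/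
lemma aux_lap {d : ℕ} (f : EuclideanSpace ℝ (Fin d) → ℝ) (hf : ContDiff ℝ 2 f) (k S : ℝ)
    (x : EuclideanSpace ℝ (Fin d))
    (hmin : ∀ y, f x + k * (max 0 (‖x‖ ^ 2 - S)) ^ 3 ≤ f y + k * (max 0 (‖y‖ ^ 2 - S)) ^ 3) :
    0 ≤ lap f x + k * (6 * d * (max 0 (‖x‖ ^ 2 - S)) ^ 2
      + 24 * (max 0 (‖x‖ ^ 2 - S)) * ‖x‖ ^ 2) := by
  set u := max 0 (‖x‖ ^ 2 - S) with hu
  have key : ∀ i : Fin d, 0 ≤ pd (fun y => pd f i y) i x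
      + k * (6 * u * (2 * x i) ^ 2 + 6 * u ^ 2) := by
    intro i
    set e : EuclideanSpace ℝ (Fin d) := EuclideanSpace.single i 1 with he
    have hline : ∀ s : ℝ, HasDerivAt (fun s : ℝ => x + s • e) e s := by
      intro s
      simpa using ((hasDerivAt_id s).smul_const e).const_add x
    let q : ℝ → ℝ := fun s => ‖x‖ ^ 2 + 2 * s * x i + s ^ 2 - S
    have hq : ∀ s, HasDerivAt q (2 * x i + 2 * s) s := by
      intro s
      have h1 : HasDerivAt (fun s : ℝ => 2 * s * x i) (2 * x i) s := by
        simpa using ((hasDerivAt_id s).const_mul 2).mul_const (x i)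
      have h2 : HasDerivAt (fun s : ℝ => s ^ 2) (2 * s) s := by
        simpa using hasDerivAt_pow 2 s
      exact ((h1.const_add _).add h2).sub_const S
    have hq0 : q 0 = ‖x‖ ^ 2 - S := by simp [q]
    have hdf : Differentiable ℝ f := hf.differentiable (by norm_num)
    have hpd : Differentiable ℝ (fun y => pd f i y) := by
      have h1 : ContDiff ℝ 1 (fderiv ℝ f) := hf.fderiv_right (by norm_num)
      exact (h1.differentiable (by norm_num)).clm_apply (differentiable_const _)
    have hA : ∀ s, HasDerivAt (fun s : ℝ => f (x + s • e) + k * (max 0 (q s)) ^ 3)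
        (pd f i (x + s • e) + k * (3 * (max 0 (q s)) ^ 2 * (2 * x i + 2 * s))) s := by
      intro s
      have h1 := (hdf (x + s • e)).hasFDerivAt.comp_hasDerivAt s (hline s)
      have h2 := ((aux_max 1 (q s)).comp s (hq s)).const_mul k
      have h3 := h1.add h2
      refine h3.congr_deriv ?_
      simp only [pd, ← he]
      push_cast
      ring
    have hB : HasDerivAt
        (fun s : ℝ => pd f i (x + s • e) + k * (3 * (max 0 (q s)) ^ 2 * (2 * x i + 2 * s)))
        (pd (fun y => pd f i y) i x + k * (6 * u * (2 * x i) ^ 2 + 6 * u ^ 2)) 0 := by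
      have h1 := (hpd (x + (0:ℝ) • e)).hasFDerivAt.comp_hasDerivAt (0:ℝ) (hline 0)
      have h2 := (aux_max 0 (q 0)).comp (0:ℝ) (hq 0)
      have h4 : HasDerivAt (fun s : ℝ => 2 * x i + 2 * s) 2 0 := by
        simpa using ((hasDerivAt_id (0:ℝ)).const_mul 2).const_add (2 * x i)
      have h3 := h1.add (((h2.const_mul 3).mul h4).const_mul k)
      have hx0 : x + (0:ℝ) • e = x := by simp
      rw [hx0] at h3
      refine h3.congr_deriv ?_
      simp only [Function.comp_def, hq0, ← hu, pd, ← he]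
      push_cast
      ring
    apply aux_second hA hB
    intro s
    have h := hmin (x + s • e)
    rw [he, aux_norm, ← he] at h
    simpa [q] using h
  have hsum := Finset.sum_nonneg (fun i (_ : i ∈ Finset.univ) => key i)
  have hn : ‖x‖ ^ 2 = ∑ i, (x i) ^ 2 := by
    rw [EuclideanSpace.norm_sq_eq]; simp
  rw [Finset.sum_add_distrib, ← Finset.mul_sum, Finset.sum_add_distrib, ← Finset.mul_sum] at hsum
  have h4 : ∑ i, (2 * x i) ^ 2 = 4 * ‖x‖ ^ 2 := by
    rw [hn, Finset.mul_sum]; exact Finset.sum_congr rfl fun i _ => by ring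
  rw [h4] at hsum
  simp only [Finset.sum_const, Finset.card_univ, Fintype.card_fin, nsmul_eq_mul] at hsum
  unfold lap
  linarith

theorem stmt_7 (d : ℕ) (T : ℝ) (hT : 0 < T)
    (a : EuclideanSpace ℝ (Fin d) → ℝ → ℝ) (a0 C : ℝ) (ha0 : 0 < a0)
    (ε : ℝ → ℝ) (hε : Filter.Tendsto ε Filter.atTop (nhds 0))
    (ha : ∀ (x : EuclideanSpace ℝ (Fin d)), ∀ t ∈ Set.Icc 0 T,
      a0 ≤ a x t ∧ a x t ≤ ε ‖x‖ * ‖x‖ ^ 2 + C)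
    (v : EuclideanSpace ℝ (Fin d) → ℝ → ℝ)
    (hcont : Continuous (fun p : EuclideanSpace ℝ (Fin d) × ℝ => v p.1 p.2))
    (hx2 : ∀ t ∈ Set.Icc 0 T, ContDiff ℝ 2 (fun y => v y t))
    (ht1 : ∀ (x : EuclideanSpace ℝ (Fin d)), ∀ t ∈ Set.Icc 0 T,
      DifferentiableAt ℝ (fun s => v x s) t)
    (m : ℝ) (hm : 0 < m)
    (hbelow : ∀ (x : EuclideanSpace ℝ (Fin d)), ∀ t ∈ Set.Icc 0 T, -m < v x t)
    (hL : ∀ (x : EuclideanSpace ℝ (Fin d)), ∀ t ∈ Set.Icc 0 T,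
      0 ≤ dt v x t - a x t * lap (fun y => v y t) x)
    (hinit : ∀ x : EuclideanSpace ℝ (Fin d), 0 ≤ v x 0) :
    ∀ (x : EuclideanSpace ℝ (Fin d)), ∀ t ∈ Set.Icc 0 T, 0 ≤ v x t := by
  -- choose the radius beyond which `ε ≤ 1`
  obtain ⟨R1, hR1⟩ := Filter.eventually_atTop.1 (hε.eventually (ge_mem_nhds (zero_lt_one)))
  set R0 := max R1 0 with hR0
  have hR00 : 0 ≤ R0 := le_max_right _ _
  set S := R0 ^ 2 with hS
  have hS0 : 0 ≤ S := sq_nonneg _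
  set B := S + |C| with hB
  have hB0 : 0 ≤ B := by positivity
  set M := 6 * (d:ℝ) + 24 + 24 * S + 6 * d * B + 24 * B + 24 * B * S with hM
  set α := M + 1 with hα
  let g : EuclideanSpace ℝ (Fin d) → ℝ := fun x => (max 0 (‖x‖ ^ 2 - S)) ^ 3
  have hg0 : ∀ x, 0 ≤ g x := fun x => by positivity
  have hgc : Continuous g := by fun_prop
  have main : ∀ δ > 0, ∀ (x : EuclideanSpace ℝ (Fin d)), ∀ t ∈ Set.Icc 0 T,
      0 ≤ v x t + δ * ((g x + 1) * Real.exp (α * t)) := by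
    intro δ hδ x1 t1 ht1'
    by_contra hneg
    push Not at hneg
    let w : EuclideanSpace ℝ (Fin d) × ℝ → ℝ :=
      fun p => v p.1 p.2 + δ * ((g p.1 + 1) * Real.exp (α * p.2))
    have hwc : Continuous w := by
      have : Continuous fun p : EuclideanSpace ℝ (Fin d) × ℝ => g p.1 := hgc.comp continuous_fst
      exact hcont.add (by fun_prop)
    have hα0 : 0 ≤ α := by positivity
    set R := Real.sqrt (S + 1 + m / δ) with hR
    have hout : ∀ (x : EuclideanSpace ℝ (Fin d)), ∀ t ∈ Set.Icc 0 T, R ≤ ‖x‖ → 0 < w (x, t) := by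
      intro x t ht hx
      have h1 : S + 1 + m / δ ≤ ‖x‖ ^ 2 := (Real.sqrt_le_left (norm_nonneg _)).1 hx
      have hmd : 0 < m / δ := by positivity
      have h2 : 1 + m / δ ≤ max 0 (‖x‖ ^ 2 - S) := le_trans (by linarith) (le_max_right _ _)
      have h3 : m / δ ≤ g x := by
        have : max 0 (‖x‖ ^ 2 - S) ≤ g x := le_self_pow₀ (by linarith) (by norm_num)
        linarith
      have h4 : 1 ≤ Real.exp (α * t) := Real.one_le_exp (mul_nonneg hα0 ht.1)
      have h5 : m / δ ≤ (g x + 1) * Real.exp (α * t) := by nlinarith [hg0 x]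
      have h6 : m ≤ δ * ((g x + 1) * Real.exp (α * t)) := by
        rw [div_le_iff₀ hδ] at h5; linarith
      have := hbelow x t ht
      simp only [w]; linarith
    have hx1 : ‖x1‖ ≤ R := by
      by_contra h
      push Not at h
      exact absurd (hout x1 t1 ht1' h.le) (not_lt.2 hneg.le)
    obtain ⟨⟨x0, t0⟩, hmem, hmin⟩ :=
      ((isCompact_closedBall (0 : EuclideanSpace ℝ (Fin d)) R).prod
        (isCompact_Icc (a := (0:ℝ)) (b := T))).exists_isMinOn
        ⟨(x1, t1), ⟨by simpa using hx1, ht1'⟩⟩ hwc.continuousOn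
    have ht0 : t0 ∈ Set.Icc 0 T := hmem.2
    have hw0 : w (x0, t0) < 0 :=
      lt_of_le_of_lt (hmin (show (x1, t1) ∈ _ from ⟨by simpa using hx1, ht1'⟩)) hneg
    have hglob : ∀ (x : EuclideanSpace ℝ (Fin d)), ∀ t ∈ Set.Icc 0 T, w (x0, t0) ≤ w (x, t) := by
      intro x t ht
      by_cases h : ‖x‖ ≤ R
      · exact hmin (show (x, t) ∈ _ from ⟨by simpa using h, ht⟩)
      · exact (hw0.trans (hout x t ht (le_of_not_ge h))).le
    have ht0pos : 0 < t0 := by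
      rcases ht0.1.lt_or_eq with h | h
      · exact h
      · exfalso
        have h1 := hinit x0
        have h2 : 0 ≤ δ * ((g x0 + 1) * Real.exp (α * t0)) := by
          have := hg0 x0
          positivity
        simp only [w] at hw0
        rw [← h] at hw0 h2
        linarith
    set E := Real.exp (α * t0) with hE
    have hEpos : 0 < E := Real.exp_pos _
    -- time derivative
    have hder : HasDerivAt (fun s => w (x0, s)) (dt v x0 t0 + δ * ((g x0 + 1) * (E * α))) t0 := by
      have h1 := (ht1 x0 t0 ht0).hasDerivAt
      have h2 : HasDerivAt (fun s => Real.exp (α * s)) (E * α) t0 := by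
        simpa using ((hasDerivAt_id t0).const_mul α).exp
      exact h1.add ((h2.const_mul (g x0 + 1)).const_mul δ)
    have htime := aux_left ht0pos hder
      (fun s hs0 hs1 => hglob x0 s ⟨hs0, hs1.trans ht0.2⟩)
    have hlap := aux_lap (fun y => v y t0) (hx2 t0 ht0) (δ * E) S x0 (by
      intro y
      have h := hglob y t0 ht0
      simp only [w, g, ← hE] at h
      linarith)
    have hPDE := hL x0 t0 ht0
    obtain ⟨hal, hau⟩ := ha x0 t0 ht0
    have hapos : 0 ≤ a x0 t0 := by linarith
    set u := max 0 (‖x0‖ ^ 2 - S) with hu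
    have hu0 : 0 ≤ u := le_max_left _ _
    have hgu : g x0 = u ^ 3 := rfl
    have hbound : a x0 t0 * (6 * d * u ^ 2 + 24 * u * ‖x0‖ ^ 2) ≤ M * (u ^ 3 + 1) := by
      have hp := aux_poly d S B u (Nat.cast_nonneg d) hS0 hB0 hu0
      rcases le_or_gt (‖x0‖ ^ 2 - S) 0 with h | h
      · have : u = 0 := max_eq_left h
        have hM0 : 0 ≤ M := by positivity
        rw [this]; simpa using hM0
      · have hu1 : u = ‖x0‖ ^ 2 - S := max_eq_right h.le
        have hr : R0 ≤ ‖x0‖ := by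
          apply le_of_sq_le_sq _ (norm_nonneg _)
          linarith
        have he := hR1 ‖x0‖ ((le_max_left _ _).trans hr)
        have h1 : a x0 t0 ≤ u + B := by
          have := mul_le_mul_of_nonneg_right he (sq_nonneg ‖x0‖)
          have := le_abs_self C
          linarith
        have h2 : ‖x0‖ ^ 2 = u + S := by linarith
        rw [h2]
        refine le_trans (mul_le_mul_of_nonneg_right h1 ?_) hp
        positivity
    have f1 := mul_nonneg hapos hlap
    have f2 := mul_le_mul_of_nonneg_left hbound (show 0 ≤ δ * E by positivity)
    have f3 : 0 < δ * E * (u ^ 3 + 1) := by positivity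
    rw [hgu] at htime
    have f4 : δ * ((u ^ 3 + 1) * (E * α)) = δ * E * (M * (u ^ 3 + 1)) + δ * E * (u ^ 3 + 1) := by
      rw [hα]; ring
    linarith
  intro x t ht
  by_contra hneg
  push Not at hneg
  have hP : 0 < (g x + 1) * Real.exp (α * t) := by
    have := hg0 x
    positivity
  set P := (g x + 1) * Real.exp (α * t) with hPdef
  have h := main (-v x t / (2 * P)) (div_pos (by linarith) (by positivity)) x t ht
  rw [← hPdef] at h
  have h2 : -v x t / (2 * P) * P = -v x t / 2 := by field_simp
  rw [h2] at h
  linarith
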